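/- Let m, n ≥ 4 and let f₁, f₂ ∈ ℂ[w₁,w₂,w₃] be squarefree homogeneous polynomials of degrees m, n with f₁(0,0,1) ≠ 0 and f₂(0,0,1) ≠ 0, such that for every (x₁,x₂) ∈ ℂ²∖{(0,0)} each of the polynomials t ↦ f₁(x₁,x₂,t) and s ↦ f₂(x₁,x₂,s) has at least 3 distinct complex roots. Let Γ = {[v] ∈ ℙ³ : f₁(v₁,v₂,v₃) = 0 and f₂(v₁,v₂,v₄) = 0}. Then there exists a nonzero homogeneous polynomial f_∞ ∈ ℂ[z₁,z₂,z₃,z₄] of degree m+n such that: for every p = (p₁,p₂,p₃) ∈ ℂ³∖{0} with f₁(p) = 0, the line ⟨p,a⟩ = {[v] : v ∈ span_ℂ{(p₁,p₂,p₃,0),(0,0,0,1)}∖{0}} contains at least 3 distinct points of Γ∖{f_∞ = 0}; and for every q = (q₁,q₂,q₄) ∈ ℂ³∖{0} with f₂(q) = 0, the line ⟨q,b⟩ = {[v] : v ∈ span_ℂ{(q₁,q₂,0,q₄),(0,0,1,0)}∖{0}} contains at least 3 distinct points of Γ∖{f_∞ = 0}. -/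

import Mathlib

open MvPolynomial

theorem Polynomial.Monic.squarefree_map_fractionRing {R : Type*} [CommRing R] [IsDomain R]
    [IsIntegrallyClosed R] {F : Polynomial R} (hF : F.Monic) (hsq : Squarefree F) :
    Squarefree (F.map (algebraMap R (FractionRing R))) := by
  intro g hg
  have hg0 : g ≠ 0 := by
    rintro rfl
    exact (hF.map _).ne_zero (by simpa using hg)
  obtain ⟨g', hg'⟩ := IsIntegrallyClosed.eq_map_mul_C_of_dvd (FractionRing R) hF
    ((dvd_mul_right g g).trans hg)
  have hlc : g.leadingCoeff ≠ 0 := Polynomial.leadingCoeff_ne_zero.mpr hg0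
  have hmonic : g'.Monic := by
    have h := congrArg Polynomial.leadingCoeff hg'
    rw [Polynomial.leadingCoeff_mul, Polynomial.leadingCoeff_C] at h
    have h1 : (g'.map (algebraMap R (FractionRing R))).Monic := by
      rw [Polynomial.Monic]
      exact mul_right_cancel₀ hlc (h.trans (one_mul _).symm)
    exact Polynomial.monic_of_injective (IsFractionRing.injective R (FractionRing R)) h1
  have hdvd : g' * g' ∣ F := by
    rw [← Polynomial.Monic.dvd_iff_fraction_map_dvd_fraction_map (K := FractionRing R) hF
      (hmonic.mul hmonic), Polynomial.map_mul]
    refine (mul_dvd_mul ?_ ?_).trans hg <;> exact ⟨_, hg'.symm⟩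
  rw [← hg']
  exact ((hsq g' hdvd).map (Polynomial.mapRingHom _)).mul
    (Polynomial.isUnit_C.mpr hlc.isUnit)

theorem Polynomial.Monic.resultant_derivative_ne_zero {R : Type*} [CommRing R] [IsDomain R]
    [CharZero R] [IsIntegrallyClosed R] {F : Polynomial R} (hF : F.Monic) (hsq : Squarefree F) :
    F.resultant F.derivative F.natDegree (F.natDegree - 1) ≠ 0 := by
  have hsep := PerfectField.separable_iff_squarefree.mpr (hF.squarefree_map_fractionRing hsq)
  have h := Polynomial.resultant_ne_zero _ _ hsep
  rw [Polynomial.natDegree_derivative, hF.natDegree_map, Polynomial.derivative_map,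
    Polynomial.resultant_map_map] at h
  exact fun h0 => h (by rw [h0, map_zero])

theorem Polynomial.Monic.card_roots_map_of_resultant_ne_zero {R : Type*} [CommRing R]
    {F : Polynomial R} (hF : F.Monic) (φ : R →+* ℂ)
    (h : φ (F.resultant F.derivative F.natDegree (F.natDegree - 1)) ≠ 0) :
    (F.map φ).roots.toFinset.card = F.natDegree := by
  rw [← Polynomial.resultant_map_map, ← Polynomial.derivative_map, ← hF.natDegree_map φ,
    ← Polynomial.natDegree_derivative] at h
  have hsep : (F.map φ).Separable := by
    by_contra hns
    exact h (Polynomial.resultant_eq_zero_iff.mpr ⟨Or.inl (hF.map φ).ne_zero, hns⟩)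
  rw [Multiset.toFinset_card_of_nodup (Polynomial.nodup_roots hsep),
    ← (IsAlgClosed.splits (F.map φ)).natDegree_eq_card_roots, hF.natDegree_map]

theorem MvPolynomial.exists_finset_forall_eval_ne_zero {d : MvPolynomial (Fin 2) ℂ} (hd : d ≠ 0)
    {P : ℂ → ℂ → Prop} (hP : ∀ l x y, l ≠ 0 → P (l * x) (l * y) → P x y)
    (hdP : ∀ x y, eval ![x, y] d ≠ 0 → P x y) :
    ∃ B : Finset ℂ, ∀ x y, x ≠ 0 → y / x ∉ B → P x y := by
  obtain ⟨v, hv⟩ : ∃ v : Fin 2 → ℂ, eval v (X 0 * d) ≠ 0 := by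
    by_contra! hall
    exact mul_ne_zero (X_ne_zero 0) hd (MvPolynomial.funext fun v => by simpa using hall v)
  rw [map_mul, eval_X] at hv
  have hv0 : v 0 ≠ 0 := left_ne_zero_of_mul hv
  have hvd : eval v d ≠ 0 := right_ne_zero_of_mul hv
  set q : Polynomial ℂ :=
    aeval ![Polynomial.C (v 0), Polynomial.C (v 0) * Polynomial.X] d with hq
  have hqe (z : ℂ) : q.eval z = eval ![v 0, v 0 * z] d := by
    rw [hq, ← Polynomial.coe_evalRingHom, MvPolynomial.aeval_def, MvPolynomial.hom_eval₂]
    have h1 : (Polynomial.evalRingHom z).comp (algebraMap ℂ (Polynomial ℂ)) = RingHom.id ℂ := by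
      ext; simp
    rw [h1, eval₂_id]
    congr 2
    funext i
    fin_cases i <;> simp
  have hq0 : q ≠ 0 := by
    intro h0
    have h1 := hqe (v 1 / v 0)
    rw [h0, mul_div_cancel₀ _ hv0] at h1
    apply hvd
    rw [show v = ![v 0, v 1] by funext i; fin_cases i <;> rfl, ← h1, Polynomial.eval_zero]
  refine ⟨q.roots.toFinset, fun x y hx hxy => ?_⟩
  refine hP (v 0 / x) x y (div_ne_zero hv0 hx) (hdP _ _ ?_)
  have h2 : q.eval (y / x) ≠ 0 := by
    simpa [hq0] using hxy
  rw [hqe] at h2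
  convert h2 using 4
  · field_simp
  · congr 1; field_simp

theorem exists_monic_squarefree {f : MvPolynomial (Fin 3) ℂ} {n : ℕ}
    (hom : f.IsHomogeneous n) (hsf : Squarefree f) (hv : eval ![0, 0, 1] f ≠ 0) :
    ∃ F : Polynomial (MvPolynomial (Fin 2) ℂ), F.Monic ∧ F.natDegree = n ∧ Squarefree F ∧
      ∃ c : ℂ, c ≠ 0 ∧ ∀ x y t, eval ![x, y, t] f = c * (F.map (eval ![x, y])).eval t := by
  let e : MvPolynomial (Fin 3) ℂ ≃ₐ[ℂ] Polynomial (MvPolynomial (Fin 2) ℂ) :=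
    (renameEquiv ℂ (finRotate 3)).trans (finSuccEquiv ℂ 2)
  have he : e f = finSuccEquiv ℂ 2 (rename (finRotate 3) f) := rfl
  have heval (x y t : ℂ) : eval ![x, y, t] f = ((e f).map (eval ![x, y])).eval t := by
    rw [he, ← eval_eq_eval_mv_eval', eval_rename]
    congr 2
    funext i
    fin_cases i <;> rfl
  have homr : (rename (finRotate 3) f).IsHomogeneous n := hom.rename_isHomogeneous
  have hdeg : (e f).natDegree ≤ n := by
    rw [he, natDegree_finSuccEquiv]
    exact (degreeOf_le_totalDegree _ _).trans homr.totalDegree_le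
  have hcoeff : (e f).coeff n = C (((e f).coeff n).coeff 0) := by
    apply totalDegree_eq_zero_iff_eq_C.mp
    exact Nat.le_zero.mp (homr.finSuccEquiv_coeff_isHomogeneous n 0 (by simp)).totalDegree_le
  set c := ((e f).coeff n).coeff 0 with hc
  have hc0 : c ≠ 0 := by
    intro h0
    apply hv
    rw [heval, Polynomial.eval_map, Polynomial.eval₂_eq_sum_range' _ (Nat.lt_succ_of_le hdeg),
      Finset.sum_range_succ, hcoeff, h0]
    simp only [map_zero, zero_mul, add_zero]
    refine Finset.sum_eq_zero fun i hi => ?_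
    have hi' := Finset.mem_range.mp hi
    have h1 := homr.finSuccEquiv_coeff_isHomogeneous i (n - i) (by omega)
    rw [show (![0, 0] : Fin 2 → ℂ) = 0 by simp, he, eval_zero, constantCoeff_eq]
    by_contra hne
    have h2 := h1 (left_ne_zero_of_mul hne)
    rw [map_zero] at h2
    omega
  have hdeg' : (e f).natDegree = n := by
    refine le_antisymm hdeg (Polynomial.le_natDegree_of_ne_zero ?_)
    rw [hcoeff]
    exact C_ne_zero.mpr hc0
  have hu : IsUnit (Polynomial.C (C c⁻¹) : Polynomial (MvPolynomial (Fin 2) ℂ)) :=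
    ((inv_ne_zero hc0).isUnit.map C).map Polynomial.C
  refine ⟨Polynomial.C (C c⁻¹) * e f, ?_, ?_, ?_, c, hc0, fun x y t => ?_⟩
  · have h1 : (e f).leadingCoeff = C c := by rw [Polynomial.leadingCoeff, hdeg', hcoeff]
    rw [Polynomial.Monic, Polynomial.leadingCoeff_mul, Polynomial.leadingCoeff_C, h1, ← C_mul,
      inv_mul_cancel₀ hc0, C_1]
  · rw [Polynomial.natDegree_C_mul (C_ne_zero.mpr (inv_ne_zero hc0)), hdeg']
  · have h1 : Squarefree (e f) := by
      intro g hg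
      have h2 := hsf (e.symm g) (by simpa using map_dvd e.symm hg)
      simpa using h2.map e
    intro g hg
    exact h1 g (hu.dvd_mul_left.mp hg)
  · rw [heval]
    simp [hc0]

theorem MvPolynomial.IsHomogeneous.eval_smul {σ : Type*} {f : MvPolynomial σ ℂ} {n : ℕ}
    (hom : f.IsHomogeneous n) (l : ℂ) (v : σ → ℂ) : eval (l • v) f = l ^ n * eval v f := by
  rw [eval_eq, eval_eq, Finset.mul_sum]
  refine Finset.sum_congr rfl fun d hd => ?_
  have h := hom (mem_support_iff.mp hd)
  rw [Finsupp.weight_apply, Finsupp.sum] at h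
  simp only [Pi.smul_apply, smul_eq_mul, mul_pow, Finset.prod_mul_distrib,
    Finset.prod_pow_eq_pow_sum]
  simp only [Pi.one_apply, smul_eq_mul, mul_one] at h
  rw [h]
  ring

theorem finite_roots {f : MvPolynomial (Fin 3) ℂ} {n : ℕ} (hom : f.IsHomogeneous n)
    (hsf : Squarefree f) (hv : eval ![0, 0, 1] f ≠ 0) (x y : ℂ) :
    {t : ℂ | eval ![x, y, t] f = 0}.Finite := by
  obtain ⟨F, hF, -, -, c, hc, hev⟩ := exists_monic_squarefree hom hsf hv
  refine (F.map (eval ![x, y])).roots.toFinset.finite_toSet.subset fun t ht => ?_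
  have h : (F.map (eval ![x, y])).eval t = 0 := by
    rw [Set.mem_ofPred_eq, hev] at ht
    exact (mul_eq_zero.mp ht).resolve_left hc
  simpa [(hF.map (eval ![x, y])).ne_zero] using h

theorem MvPolynomial.IsHomogeneous.eval_mul_vec3 {f : MvPolynomial (Fin 3) ℂ} {n : ℕ}
    (hom : f.IsHomogeneous n) (l x y t : ℂ) :
    eval ![l * x, l * y, l * t] f = l ^ n * eval ![x, y, t] f := by
  rw [← hom.eval_smul]
  simp

theorem exists_finset_forall_degree_le_card_roots {f : MvPolynomial (Fin 3) ℂ} {n : ℕ}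
    (hom : f.IsHomogeneous n) (hsf : Squarefree f) (hv : eval ![0, 0, 1] f ≠ 0) :
    ∃ B : Finset ℂ, ∀ x y, x ≠ 0 → y / x ∉ B →
      ∃ S : Finset ℂ, n ≤ S.card ∧ ∀ t ∈ S, eval ![x, y, t] f = 0 := by
  obtain ⟨F, hF, hdeg, hsq, c, hc, hev⟩ := exists_monic_squarefree hom hsf hv
  refine exists_finset_forall_eval_ne_zero (hF.resultant_derivative_ne_zero hsq) ?_ ?_
  · rintro l x y hl ⟨S, hS, hroot⟩
    refine ⟨S.image (l⁻¹ * ·), ?_, ?_⟩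
    · rwa [Finset.card_image_of_injective _ (mul_right_injective₀ (inv_ne_zero hl))]
    · simp only [Finset.mem_image, forall_exists_index, and_imp]
      rintro _ t ht rfl
      have h := hom.eval_mul_vec3 l x y (l⁻¹ * t)
      rw [mul_inv_cancel_left₀ hl, hroot t ht] at h
      exact (mul_eq_zero.mp h.symm).resolve_left (pow_ne_zero _ hl)
  · intro x y hxy
    refine ⟨_, ((hF.card_roots_map_of_resultant_ne_zero _ hxy).trans hdeg).ge, fun t ht => ?_⟩
    rw [hev, (Polynomial.mem_roots'.mp (Multiset.mem_toFinset.mp ht)).2, mul_zero]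

theorem exists_three_affine_ne_zero {P : ℂ → Prop} {A c : ℂ} (hc : c ≠ 0)
    (h : (∃ S : Finset ℂ, 4 ≤ S.card ∧ ∀ t ∈ S, P t) ∨ ∀ t, P t → A + t * c ≠ 0)
    (h3 : ∃ t₁ t₂ t₃ : ℂ, t₁ ≠ t₂ ∧ t₁ ≠ t₃ ∧ t₂ ≠ t₃ ∧ P t₁ ∧ P t₂ ∧ P t₃) :
    ∃ t₁ t₂ t₃ : ℂ, t₁ ≠ t₂ ∧ t₁ ≠ t₃ ∧ t₂ ≠ t₃ ∧
      ∀ t, t = t₁ ∨ t = t₂ ∨ t = t₃ → P t ∧ A + t * c ≠ 0 := by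
  rcases h with ⟨S, hS, hP⟩ | h
  · have hcard : 2 < (S.erase (-A / c)).card := by
      have := Finset.pred_card_le_card_erase (s := S) (a := -A / c)
      omega
    obtain ⟨t₁, h₁, t₂, h₂, t₃, h₃, h12, h13, h23⟩ := Finset.two_lt_card.mp hcard
    have key : ∀ t ∈ S.erase (-A / c), P t ∧ A + t * c ≠ 0 := by
      intro t ht
      refine ⟨hP t (Finset.mem_of_mem_erase ht), fun h0 => Finset.ne_of_mem_erase ht ?_⟩
      rw [eq_div_iff hc]
      linear_combination h0
    refine ⟨t₁, t₂, t₃, h12, h13, h23, ?_⟩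
    rintro t (rfl | rfl | rfl) <;> exact key _ ‹_›
  · obtain ⟨t₁, t₂, t₃, h12, h13, h23, h₁, h₂, h₃⟩ := h3
    refine ⟨t₁, t₂, t₃, h12, h13, h23, ?_⟩
    rintro t (rfl | rfl | rfl) <;> exact ⟨‹_›, h _ ‹_›⟩

theorem LinearIndependent.pair_add_smul_add_smul {K V : Type*} [Field K] [AddCommGroup V]
    [Module K V] {w e : V} (hwe : LinearIndependent K ![w, e]) {s t : K} (hst : s ≠ t) :
    LinearIndependent K ![w + s • e, w + t • e] := by
  rw [LinearIndependent.pair_iff] at hwe ⊢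
  intro a b hab
  obtain ⟨h1, h2⟩ := hwe (a + b) (a * s + b * t) (by rw [← hab]; module)
  have hb : b = -a := by linear_combination h1
  have ha : a * (s - t) = 0 := by rw [hb] at h2; linear_combination h2
  have ha0 := (mul_eq_zero.mp ha).resolve_right (sub_ne_zero.mpr hst)
  exact ⟨ha0, by rw [hb, ha0, neg_zero]⟩

theorem exists_three_points_on_line {w e : Fin 4 → ℂ} (hwe : LinearIndependent ℂ ![w, e])
    {Q : (Fin 4 → ℂ) → Prop}
    (h : ∃ t₁ t₂ t₃ : ℂ, t₁ ≠ t₂ ∧ t₁ ≠ t₃ ∧ t₂ ≠ t₃ ∧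
      ∀ t, t = t₁ ∨ t = t₂ ∨ t = t₃ → Q (w + t • e)) :
    ∃ v₁ v₂ v₃ : Fin 4 → ℂ, v₁ ≠ 0 ∧ v₂ ≠ 0 ∧ v₃ ≠ 0 ∧
      LinearIndependent ℂ ![v₁, v₂] ∧ LinearIndependent ℂ ![v₁, v₃] ∧
      LinearIndependent ℂ ![v₂, v₃] ∧
      (∀ v ∈ ({v₁, v₂, v₃} : Set (Fin 4 → ℂ)), v ∈ Submodule.span ℂ {w, e} ∧ Q v) := by
  obtain ⟨t₁, t₂, t₃, h12, h13, h23, hQ⟩ := h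
  have l12 := hwe.pair_add_smul_add_smul h12
  have l13 := hwe.pair_add_smul_add_smul h13
  have l23 := hwe.pair_add_smul_add_smul h23
  refine ⟨w + t₁ • e, w + t₂ • e, w + t₃ • e, l12.ne_zero 0, l12.ne_zero 1, l13.ne_zero 1,
    l12, l13, l23, ?_⟩
  have hspan (t : ℂ) : w + t • e ∈ Submodule.span ℂ {w, e} :=
    Submodule.mem_span_pair.mpr ⟨1, t, by rw [one_smul]⟩
  rintro v (rfl | rfl | rfl)
  · exact ⟨hspan _, hQ _ (by simp)⟩
  · exact ⟨hspan _, hQ _ (by simp)⟩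
  · exact ⟨hspan _, hQ _ (by simp)⟩

theorem fst_snd_ne_zero_of_eval_eq_zero {f : MvPolynomial (Fin 3) ℂ} {n : ℕ}
    (hom : f.IsHomogeneous n) (hv : eval ![0, 0, 1] f ≠ 0) {x y t : ℂ}
    (h0 : ![x, y, t] ≠ 0) (h : eval ![x, y, t] f = 0) : (x, y) ≠ 0 := by
  rintro hxy
  obtain ⟨rfl, rfl⟩ := Prod.mk_eq_zero.mp hxy
  have h1 := hom.eval_mul_vec3 t 0 0 1
  rw [mul_zero, mul_one, h] at h1
  have ht : t = 0 := eq_zero_of_pow_eq_zero ((mul_eq_zero.mp h1.symm).resolve_right hv)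
  exact h0 (by simp [ht])

/-- A linear form that vanishes neither at the two vertices nor at any point of the double
curve lying over `x₁ = 0` or over one of finitely many given slopes `x₂ / x₁`. -/
theorem exists_dual_ne_zero {m n : ℕ} {f₁ f₂ : MvPolynomial (Fin 3) ℂ}
    (hom₁ : f₁.IsHomogeneous m) (hom₂ : f₂.IsHomogeneous n)
    (hfin₁ : ∀ x y, {t : ℂ | eval ![x, y, t] f₁ = 0}.Finite)
    (hfin₂ : ∀ x y, {t : ℂ | eval ![x, y, t] f₂ = 0}.Finite) (B : Finset ℂ) :
    ∃ φ : Module.Dual ℂ (Fin 4 → ℂ), φ ![0, 0, 1, 0] ≠ 0 ∧ φ ![0, 0, 0, 1] ≠ 0 ∧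
      ∀ x y t s, (x, y) ≠ 0 → (x = 0 ∨ y / x ∈ B) → eval ![x, y, t] f₁ = 0 →
        eval ![x, y, s] f₂ = 0 → φ ![x, y, t, s] ≠ 0 := by
  set T : Set (ℂ × ℂ) := insert (0, 1) ((fun b => (1, b)) '' (B : Set ℂ)) with hT
  have hTfin : T.Finite := (B.finite_toSet.image _).insert _
  have hT0 : ∀ z ∈ T, z ≠ 0 := by
    rintro z (rfl | ⟨b, -, rfl⟩) <;> simp
  set S : Set (Fin 4 → ℂ) := insert ![0, 0, 1, 0] (insert ![0, 0, 0, 1]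
    (⋃ z ∈ T, (fun p : ℂ × ℂ => ![z.1, z.2, p.1, p.2]) ''
      ({t | eval ![z.1, z.2, t] f₁ = 0} ×ˢ {s | eval ![z.1, z.2, s] f₂ = 0}))) with hS
  have hSfin : S.Finite :=
    ((hTfin.biUnion fun z _ => ((hfin₁ _ _).prod (hfin₂ _ _)).image _).insert _).insert _
  have hS0 : ∀ v ∈ S, v ≠ 0 := by
    rintro v (rfl | rfl | hv)
    · exact fun h => by simpa using congrFun h 2
    · exact fun h => by simpa using congrFun h 3
    · simp only [Set.mem_iUnion] at hv
      obtain ⟨z, hz, p, -, rfl⟩ := hv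
      exact fun h => hT0 z hz (Prod.ext (congrFun h 0) (congrFun h 1))
  have := hSfin.to_subtype
  obtain ⟨φ, hφ⟩ := Module.exists_dual_forall_apply_ne_zero (K := ℂ)
    (fun v : S => (v : Fin 4 → ℂ)) fun v => hS0 v v.2
  have hφS : ∀ v ∈ S, φ v ≠ 0 := fun v hv => hφ ⟨v, hv⟩
  refine ⟨φ, hφS _ (by simp [hS]), hφS _ (by simp [hS]), fun x y t s hxy hbad h₁ h₂ => ?_⟩
  obtain ⟨l, hl⟩ : ∃ l : ℂ, (l * x, l * y) ∈ T := by
    by_cases hx : x = 0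
    · have hy : y ≠ 0 := fun hy => hxy (by simp [hx, hy])
      exact ⟨y⁻¹, Or.inl (by simp [hx, hy])⟩
    · refine ⟨x⁻¹, Or.inr ⟨y / x, hbad.resolve_left hx, ?_⟩⟩
      simp [hx, div_eq_inv_mul]
  have hmem : ![l * x, l * y, l * t, l * s] ∈ S := by
    refine Or.inr (Or.inr (Set.mem_biUnion hl ⟨(l * t, l * s), ⟨?_, ?_⟩, rfl⟩))
    · simp [hom₁.eval_mul_vec3, h₁]
    · simp [hom₂.eval_mul_vec3, h₂]
  have h := hφS _ hmem
  rw [show ![l * x, l * y, l * t, l * s] = l • ![x, y, t, s] by simp, map_smul] at h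
  exact right_ne_zero_of_mul h

theorem MvPolynomial.exists_isHomogeneous_eval_eq_dual_pow {σ : Type*} [Fintype σ]
    (φ : Module.Dual ℂ (σ → ℂ)) (k : ℕ) :
    ∃ g : MvPolynomial σ ℂ, g.IsHomogeneous k ∧ ∀ v, eval v g = φ v ^ k := by
  classical
  refine ⟨(∑ i, C (φ fun j => if i = j then 1 else 0) * X i) ^ k, ?_, fun v => ?_⟩
  · have h : (∑ i, C (φ fun j => if i = j then 1 else 0) * X i : MvPolynomial σ ℂ).IsHomogeneous 1 :=
      IsHomogeneous.sum _ _ _ fun i _ => isHomogeneous_C_mul_X _ _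
    simpa using h.pow k
  · rw [map_pow, map_sum, φ.pi_apply_eq_sum_univ v]
    simp [mul_comm]

/-- There is a (general) surface `X_∞ = {f_∞ = 0}` of degree `m + n`
such that every ruling line `⟨p,a⟩` of the first cone through a point `p` of its base
curve, and every ruling line `⟨q,b⟩` of the second cone through a point `q` of its base
curve, contains at least 3 distinct points of the double curve `Γ` not lying on
`X_∞`. -/
theorem general_Xinf_three_points_on_rulings
    (m n : ℕ) (hm : 4 ≤ m) (hn : 4 ≤ n)
    (f₁ f₂ : MvPolynomial (Fin 3) ℂ)
    (hsf₁ : Squarefree f₁) (hsf₂ : Squarefree f₂)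
    (hf₁hom : f₁.IsHomogeneous m) (hf₂hom : f₂.IsHomogeneous n)
    (hf₁v : eval ![0, 0, 1] f₁ ≠ 0) (hf₂v : eval ![0, 0, 1] f₂ ≠ 0)
    (hf₁3 : ∀ x₁ x₂ : ℂ, (x₁, x₂) ≠ 0 → ∃ t₁ t₂ t₃ : ℂ, t₁ ≠ t₂ ∧ t₁ ≠ t₃ ∧ t₂ ≠ t₃ ∧
      eval ![x₁, x₂, t₁] f₁ = 0 ∧ eval ![x₁, x₂, t₂] f₁ = 0 ∧ eval ![x₁, x₂, t₃] f₁ = 0)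
    (hf₂3 : ∀ x₁ x₂ : ℂ, (x₁, x₂) ≠ 0 → ∃ s₁ s₂ s₃ : ℂ, s₁ ≠ s₂ ∧ s₁ ≠ s₃ ∧ s₂ ≠ s₃ ∧
      eval ![x₁, x₂, s₁] f₂ = 0 ∧ eval ![x₁, x₂, s₂] f₂ = 0 ∧ eval ![x₁, x₂, s₃] f₂ = 0) :
    ∃ finf : MvPolynomial (Fin 4) ℂ, finf ≠ 0 ∧ finf.IsHomogeneous (m + n) ∧
      (∀ p : Fin 3 → ℂ, p ≠ 0 → eval p f₁ = 0 →
        ∃ v₁ v₂ v₃ : Fin 4 → ℂ, v₁ ≠ 0 ∧ v₂ ≠ 0 ∧ v₃ ≠ 0 ∧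
          LinearIndependent ℂ ![v₁, v₂] ∧ LinearIndependent ℂ ![v₁, v₃] ∧
          LinearIndependent ℂ ![v₂, v₃] ∧
          (∀ v ∈ ({v₁, v₂, v₃} : Set (Fin 4 → ℂ)),
            v ∈ Submodule.span ℂ {![p 0, p 1, p 2, 0], ![0, 0, 0, 1]} ∧
            eval ![v 0, v 1, v 2] f₁ = 0 ∧ eval ![v 0, v 1, v 3] f₂ = 0 ∧
            eval v finf ≠ 0)) ∧
      (∀ q : Fin 3 → ℂ, q ≠ 0 → eval q f₂ = 0 →
        ∃ v₁ v₂ v₃ : Fin 4 → ℂ, v₁ ≠ 0 ∧ v₂ ≠ 0 ∧ v₃ ≠ 0 ∧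
          LinearIndependent ℂ ![v₁, v₂] ∧ LinearIndependent ℂ ![v₁, v₃] ∧
          LinearIndependent ℂ ![v₂, v₃] ∧
          (∀ v ∈ ({v₁, v₂, v₃} : Set (Fin 4 → ℂ)),
            v ∈ Submodule.span ℂ {![q 0, q 1, 0, q 2], ![0, 0, 1, 0]} ∧
            eval ![v 0, v 1, v 2] f₁ = 0 ∧ eval ![v 0, v 1, v 3] f₂ = 0 ∧
            eval v finf ≠ 0)) := by
  obtain ⟨B₁, hB₁⟩ := exists_finset_forall_degree_le_card_roots hf₁hom hsf₁ hf₁v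
  obtain ⟨B₂, hB₂⟩ := exists_finset_forall_degree_le_card_roots hf₂hom hsf₂ hf₂v
  obtain ⟨φ, hφa, hφb, hφ⟩ := exists_dual_ne_zero hf₁hom hf₂hom
    (finite_roots hf₁hom hsf₁ hf₁v) (finite_roots hf₂hom hsf₂ hf₂v) (B₁ ∪ B₂)
  obtain ⟨g, hg, hgev⟩ := exists_isHomogeneous_eval_eq_dual_pow φ (m + n)
  refine ⟨g, ?_, hg, ?_, ?_⟩
  · rintro rfl
    exact pow_ne_zero (m + n) hφa (by rw [← hgev, map_zero])
  · intro p hp hp₁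
    have hpv : p = ![p 0, p 1, p 2] := by funext i; fin_cases i <;> rfl
    rw [hpv] at hp hp₁
    have hxy := fst_snd_ne_zero_of_eval_eq_zero hf₁hom hf₁v hp hp₁
    have hadd (s : ℂ) : (![p 0, p 1, p 2, 0] + s • ![0, 0, 0, 1] : Fin 4 → ℂ)
      = ![p 0, p 1, p 2, s] := by simp
    apply exists_three_points_on_line
    · rw [LinearIndependent.pair_iff]
      intro a b hab
      have h0 := congrFun hab 0
      have h1 := congrFun hab 1
      have h3 := congrFun hab 3
      simp at h0 h1 h3
      simp only [ne_eq, Prod.mk_eq_zero] at hxy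
      tauto
    have h3 := exists_three_affine_ne_zero (P := fun s => eval ![p 0, p 1, s] f₂ = 0)
      (A := φ ![p 0, p 1, p 2, 0]) hφb ?_ (hf₂3 _ _ hxy)
    · obtain ⟨s₁, s₂, s₃, h12, h13, h23, h⟩ := h3
      refine ⟨s₁, s₂, s₃, h12, h13, h23, fun s hs => ?_⟩
      obtain ⟨hs₂, hsφ⟩ := h s hs
      rw [← smul_eq_mul, ← map_smul, ← map_add] at hsφ
      rw [hgev]
      refine ⟨?_, ?_, pow_ne_zero _ hsφ⟩
      · rw [hadd]; exact hp₁
      · rw [hadd]; exact hs₂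
    · by_cases hbad : p 0 = 0 ∨ p 1 / p 0 ∈ B₁ ∪ B₂
      · refine Or.inr fun s hs => ?_
        rw [← smul_eq_mul, ← map_smul, ← map_add, hadd]
        exact hφ _ _ _ _ hxy hbad hp₁ hs
      · rw [Finset.mem_union] at hbad
        push Not at hbad
        obtain ⟨S, hS, hroot⟩ := hB₂ _ _ hbad.1 hbad.2.2
        exact Or.inl ⟨S, hn.trans hS, hroot⟩
  · intro q hq hq₂
    have hqv : q = ![q 0, q 1, q 2] := by funext i; fin_cases i <;> rfl
    rw [hqv] at hq hq₂
    have hxy := fst_snd_ne_zero_of_eval_eq_zero hf₂hom hf₂v hq hq₂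
    have hadd (t : ℂ) : (![q 0, q 1, 0, q 2] + t • ![0, 0, 1, 0] : Fin 4 → ℂ)
      = ![q 0, q 1, t, q 2] := by simp
    apply exists_three_points_on_line
    · rw [LinearIndependent.pair_iff]
      intro a b hab
      have h0 := congrFun hab 0
      have h1 := congrFun hab 1
      have h2 := congrFun hab 2
      simp at h0 h1 h2
      simp only [ne_eq, Prod.mk_eq_zero] at hxy
      tauto
    have h3 := exists_three_affine_ne_zero (P := fun t => eval ![q 0, q 1, t] f₁ = 0)
      (A := φ ![q 0, q 1, 0, q 2]) hφa ?_ (hf₁3 _ _ hxy)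
    · obtain ⟨t₁, t₂, t₃, h12, h13, h23, h⟩ := h3
      refine ⟨t₁, t₂, t₃, h12, h13, h23, fun t ht => ?_⟩
      obtain ⟨ht₁, htφ⟩ := h t ht
      rw [← smul_eq_mul, ← map_smul, ← map_add] at htφ
      rw [hgev]
      refine ⟨?_, ?_, pow_ne_zero _ htφ⟩
      · rw [hadd]; exact ht₁
      · rw [hadd]; exact hq₂
    · by_cases hbad : q 0 = 0 ∨ q 1 / q 0 ∈ B₁ ∪ B₂
      · refine Or.inr fun t ht => ?_
        rw [← smul_eq_mul, ← map_smul, ← map_add, hadd]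
        exact hφ _ _ _ _ hxy hbad ht hq₂
      · rw [Finset.mem_union] at hbad
        push Not at hbad
        obtain ⟨S, hS, hroot⟩ := hB₁ _ _ hbad.1 hbad.2.1
        exact Or.inl ⟨S, hm.trans hS, hroot⟩
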